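/- Let G_1 and G_2 be maxnil graphs and let G be the clique sum of G_1 and G_2 over K_2, i.e., V(G_1) ∩ V(G_2) consists of the two endpoints of an edge e lying in both G_1 and G_2, V(G) = V(G_1) ∪ V(G_2), and E(G) = E(G_1) ∪ E(G_2). Then G is maxnil if and only if e is non-triangular in at least one of G_1, G_2. -/

import Mathlib

open SimpleGraph

/-- `H` is a minor of `G`: there is a family of nonempty, pairwise disjoint,
connected branch sets in `G`, one for each vertex of `H`, with an edge of `G`
between the branch sets of any two adjacent vertices of `H`. -/
def IsMinor {W V : Type} (H : SimpleGraph W) (G : SimpleGraph V) : Prop :=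
  ∃ f : W → Set V,
    (∀ w, (f w).Nonempty) ∧
    (∀ w, (G.induce (f w)).Connected) ∧
    (Pairwise fun w₁ w₂ => Disjoint (f w₁) (f w₂)) ∧
    ∀ ⦃w₁ w₂⦄, H.Adj w₁ w₂ → ∃ v₁ ∈ f w₁, ∃ v₂ ∈ f w₂, G.Adj v₁ v₂

/-- The result of a `∇Y`-move on the triangle `a b c` of `G`: delete the edges of
the triangle and add a new vertex (`none`) joined to `a`, `b`, `c`. -/
def triangleY {V : Type} (G : SimpleGraph V) (a b c : V) : SimpleGraph (Option V) :=
  (SimpleGraph.map Function.Embedding.some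
      (G.deleteEdges {s(a, b), s(b, c), s(a, c)})) ⊔
    SimpleGraph.fromEdgeSet {s((none : Option V), some a), s(none, some b), s(none, some c)}

/-- Membership in the Petersen family: the graphs obtained from `K₆` by
`∇Y`-moves and `Y∇`-moves (the inverse operation), up to isomorphism. -/
inductive IsPetersenFamily : ∀ {V : Type}, SimpleGraph V → Prop
  | k6 : IsPetersenFamily (⊤ : SimpleGraph (Fin 6))
  | deltaY {V : Type} {G : SimpleGraph V} {a b c : V} :
      IsPetersenFamily G → G.Adj a b → G.Adj b c → G.Adj a c →
      IsPetersenFamily (triangleY G a b c)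
  | yDelta {V : Type} {G : SimpleGraph V} {a b c : V} :
      IsPetersenFamily (triangleY G a b c) → G.Adj a b → G.Adj b c → G.Adj a c →
      IsPetersenFamily G
  | iso {V W : Type} {G : SimpleGraph V} {H : SimpleGraph W} :
      IsPetersenFamily G → G ≃g H → IsPetersenFamily H

/-- A graph is linklessly embeddable (nIL) iff it has no minor in the Petersen family. -/
def IsLinkless {V : Type} (G : SimpleGraph V) : Prop :=
  ∀ ⦃W : Type⦄ (P : SimpleGraph W), IsPetersenFamily P → ¬ IsMinor P G

/-- The graph obtained from `G` by adding the edge `ab`. -/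
def addEdge {V : Type} (G : SimpleGraph V) (a b : V) : SimpleGraph V :=
  G ⊔ SimpleGraph.fromEdgeSet {s(a, b)}

/-- A nIL graph is maxnil if adding any edge yields a graph that is not nIL. -/
def IsMaxnil {V : Type} (G : SimpleGraph V) : Prop :=
  IsLinkless G ∧ ∀ a b : V, a ≠ b → ¬ G.Adj a b → ¬ IsLinkless (addEdge G a b)

/-- `S` is a vertex cut set of the connected graph `G` if `G - S` is disconnected. -/
def IsVertexCut {V : Type} (G : SimpleGraph V) (S : Set V) : Prop :=
  G.Connected ∧ ¬ (G.induce Sᶜ).Preconnected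

/-- A vertex cut set is minimal if no proper subset of it is a vertex cut set. -/
def IsMinimalVertexCut {V : Type} (G : SimpleGraph V) (S : Set V) : Prop :=
  IsVertexCut G S ∧ ∀ S' ⊂ S, ¬ IsVertexCut G S'

/-- A set `T` of vertices of `H` (inducing a `K₄`) is strongly separating if `H - T`
has at least two connected components such that every vertex of `T` has a
neighbor in each of them. -/
def StronglySeparating {V : Type} (H : SimpleGraph V) (T : Set V) : Prop :=
  ∃ C₁ C₂ : (H.induce Tᶜ).ConnectedComponent, C₁ ≠ C₂ ∧
    ∀ v ∈ T, (∃ u ∈ C₁.supp, H.Adj v ↑u) ∧ (∃ u ∈ C₂.supp, H.Adj v ↑u)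

/-- `G` is maximal without a `K₆` minor. -/
def IsMaximalK6MinorFree {V : Type} (G : SimpleGraph V) : Prop :=
  ¬ IsMinor (⊤ : SimpleGraph (Fin 6)) G ∧
    ∀ a b : V, a ≠ b → ¬ G.Adj a b → IsMinor (⊤ : SimpleGraph (Fin 6)) (addEdge G a b)

def pfRows : List (List ℕ) :=
  [[62, 61, 59, 55, 47, 31],
   [120, 120, 120, 55, 47, 31, 7],
   [224, 120, 120, 166, 166, 31, 7, 25],
   [120, 120, 120, 135, 135, 135, 7, 56],
   [224, 336, 120, 388, 166, 277, 7, 25, 42],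
   [60, 60, 83, 83, 111, 83, 60],
   [224, 336, 584, 388, 642, 769, 7, 25, 42, 52]]

def pfD : List (ℕ × ℕ × ℕ × List ℕ) :=
  [(0, 7, 1, [0, 1, 2, 3, 4, 5, 6]),
   (0, 11, 1, [0, 1, 3, 2, 4, 5, 6]),
   (0, 19, 1, [0, 1, 3, 4, 2, 5, 6]),
   (0, 35, 1, [0, 1, 3, 4, 5, 2, 6]),
   (0, 13, 1, [0, 3, 1, 2, 4, 5, 6]),
   (0, 21, 1, [0, 3, 1, 4, 2, 5, 6]),
   (0, 37, 1, [0, 3, 1, 4, 5, 2, 6]),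
   (0, 25, 1, [0, 3, 4, 1, 2, 5, 6]),
   (0, 41, 1, [0, 3, 4, 1, 5, 2, 6]),
   (0, 49, 1, [0, 3, 4, 5, 1, 2, 6]),
   (0, 14, 1, [3, 0, 1, 2, 4, 5, 6]),
   (0, 22, 1, [3, 0, 1, 4, 2, 5, 6]),
   (0, 38, 1, [3, 0, 1, 4, 5, 2, 6]),
   (0, 26, 1, [3, 0, 4, 1, 2, 5, 6]),
   (0, 42, 1, [3, 0, 4, 1, 5, 2, 6]),
   (0, 50, 1, [3, 0, 4, 5, 1, 2, 6]),
   (0, 28, 1, [3, 4, 0, 1, 2, 5, 6]),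
   (0, 44, 1, [3, 4, 0, 1, 5, 2, 6]),
   (0, 52, 1, [3, 4, 0, 5, 1, 2, 6]),
   (0, 56, 1, [3, 4, 5, 0, 1, 2, 6]),
   (1, 25, 2, [0, 1, 2, 3, 4, 5, 6, 7]),
   (1, 41, 2, [0, 1, 2, 3, 5, 4, 6, 7]),
   (1, 49, 2, [0, 1, 2, 5, 3, 4, 6, 7]),
   (1, 26, 2, [1, 0, 2, 3, 4, 5, 6, 7]),
   (1, 42, 2, [1, 0, 2, 3, 5, 4, 6, 7]),
   (1, 50, 2, [1, 0, 2, 5, 3, 4, 6, 7]),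
   (1, 28, 2, [1, 2, 0, 3, 4, 5, 6, 7]),
   (1, 44, 2, [1, 2, 0, 3, 5, 4, 6, 7]),
   (1, 52, 2, [1, 2, 0, 5, 3, 4, 6, 7]),
   (1, 56, 3, [0, 1, 2, 3, 4, 5, 6, 7]),
   (2, 42, 4, [0, 1, 2, 3, 4, 5, 6, 7, 8]),
   (2, 50, 4, [0, 1, 2, 4, 3, 5, 6, 7, 8]),
   (2, 44, 4, [0, 2, 1, 3, 4, 5, 6, 7, 8]),
   (2, 52, 4, [0, 2, 1, 4, 3, 5, 6, 7, 8]),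
   (4, 52, 6, [0, 1, 2, 3, 4, 5, 6, 7, 8, 9]),
   (5, 21, 2, [6, 3, 7, 1, 5, 2, 4, 0]),
   (5, 25, 2, [6, 3, 1, 7, 5, 2, 4, 0]),
   (5, 49, 2, [6, 3, 1, 2, 5, 7, 4, 0]),
   (5, 22, 2, [1, 7, 6, 3, 5, 4, 2, 0]),
   (5, 26, 2, [1, 7, 3, 6, 5, 4, 2, 0]),
   (5, 50, 2, [1, 7, 3, 4, 5, 6, 2, 0]),
   (5, 84, 2, [1, 2, 6, 3, 5, 4, 7, 0]),
   (5, 88, 2, [1, 2, 3, 6, 5, 4, 7, 0]),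
   (5, 112, 2, [1, 2, 3, 4, 5, 6, 7, 0])]

def pfY : List (ℕ × ℕ × ℕ × List ℕ) :=
  [(1, 6, 0, [0, 1, 2, 3, 4, 5, 0]),
   (2, 0, 5, [0, 0, 1, 2, 3, 4, 5, 6]),
   (2, 6, 1, [0, 3, 4, 1, 2, 5, 0, 6]),
   (2, 7, 1, [0, 1, 2, 3, 4, 5, 6, 0]),
   (3, 6, 1, [3, 4, 5, 0, 1, 2, 0, 6]),
   (3, 7, 1, [0, 1, 2, 3, 4, 5, 6, 0]),
   (4, 0, 2, [0, 6, 3, 7, 1, 5, 2, 4, 0]),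
   (4, 1, 2, [6, 0, 3, 7, 5, 1, 2, 0, 4]),
   (4, 3, 2, [6, 7, 5, 0, 3, 1, 0, 2, 4]),
   (4, 6, 2, [1, 3, 5, 0, 2, 4, 0, 6, 7]),
   (4, 7, 2, [1, 0, 2, 3, 5, 4, 6, 0, 7]),
   (4, 8, 2, [0, 1, 2, 3, 4, 5, 6, 7, 0]),
   (6, 0, 4, [0, 0, 8, 1, 7, 2, 5, 4, 6, 3]),
   (6, 1, 4, [0, 0, 8, 1, 2, 7, 5, 6, 4, 3]),
   (6, 2, 4, [0, 8, 0, 2, 1, 7, 5, 6, 3, 4]),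
   (6, 3, 4, [0, 1, 2, 0, 8, 7, 6, 5, 4, 3]),
   (6, 4, 4, [0, 2, 1, 8, 0, 7, 6, 5, 3, 4]),
   (6, 5, 4, [2, 0, 1, 8, 7, 0, 6, 3, 5, 4]),
   (6, 6, 4, [2, 4, 5, 0, 1, 3, 0, 6, 7, 8]),
   (6, 7, 4, [2, 0, 1, 4, 5, 3, 6, 0, 7, 8]),
   (6, 8, 4, [0, 2, 1, 4, 3, 5, 6, 7, 0, 8]),
   (6, 9, 4, [0, 1, 2, 3, 4, 5, 6, 7, 8, 0])]

def pfN (i : ℕ) : ℕ := [6, 7, 8, 8, 9, 7, 10].getD i 0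

/-- Bitmask of the neighbours of vertex `k` in the `i`-th graph of the list. -/
def pfRow (i k : ℕ) : ℕ := (pfRows.getD i []).getD k 0

def pfAdj (i k l : ℕ) : Bool := (pfRow i k).testBit l

def allLt (n : ℕ) (p : ℕ → Bool) : Bool := (List.range n).all p
def anyLt (n : ℕ) (p : ℕ → Bool) : Bool := (List.range n).any p

lemma allLt_iff {n : ℕ} {p : ℕ → Bool} : allLt n p = true ↔ ∀ k < n, p k = true := by
  simp [allLt]

lemma anyLt_iff {n : ℕ} {p : ℕ → Bool} : anyLt n p = true ↔ ∃ k < n, p k = true := by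
  simp [anyLt]

/-- Validity of a row of the table of `∇Y`-moves. -/
def okD (r : ℕ × ℕ × ℕ × List ℕ) : Bool :=
  let i := r.1
  let s := r.2.1
  let j := r.2.2.1
  let p := fun k => r.2.2.2.getD k 0
  let n := pfN i
  (decide (j < 7)) && (pfN j == n + 1) &&
  allLt (n + 1) (fun k => decide (p k < n + 1) && anyLt (n + 1) (fun l => p l == k) &&
    allLt (n + 1) (fun l => k == l || p k != p l)) &&
  allLt n (fun k => (pfAdj j (p n) (p k) == s.testBit k) && (pfAdj j (p k) (p n) == s.testBit k) &&
    allLt n (fun l => pfAdj j (p k) (p l) == (pfAdj i k l && !(s.testBit k && s.testBit l)))) &&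
  !(pfAdj j (p n) (p n))

/-- Validity of a row of the table of `Y∇`-moves. -/
def okY (r : ℕ × ℕ × ℕ × List ℕ) : Bool :=
  let j := r.1
  let v := r.2.1
  let i := r.2.2.1
  let q := fun k => r.2.2.2.getD k 0
  let n := pfN j
  (decide (i < 7)) &&
  allLt n (fun k => k == v || (decide (q k < pfN i) &&
    allLt n (fun l => l == v || (k == l || q k != q l) &&
      (pfAdj i (q k) (q l) == (pfAdj j k l || (k != l && pfAdj j v k && pfAdj j v l)))))) &&
  allLt (pfN i) (fun t => anyLt n (fun k => k != v && q k == t))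

lemma okD_all : pfD.all okD = true := by decide +kernel
lemma okY_all : pfY.all okY = true := by decide +kernel

def complD : Bool :=
  allLt 7 fun i => allLt (pfN i) fun a => allLt (pfN i) fun b => !(pfAdj i a b) ||
    allLt (pfN i) fun c => !(pfAdj i b c) || !(pfAdj i a c) ||
      pfD.any fun r => r.1 == i && allLt (pfN i) fun k =>
        r.2.1.testBit k == (k == a || k == b || k == c)

lemma complD_true : complD = true := by decide +kernel

def complY : Bool :=
  allLt 7 fun j => allLt (pfN j) fun v => (pfY.any fun r => r.1 == j && r.2.1 == v) ||
    allLt (pfN j) fun a => allLt (pfN j) fun b => allLt (pfN j) fun c =>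
      anyLt (pfN j) fun k => pfAdj j v k && k != a && k != b && k != c

lemma complY_true : complY = true := by decide +kernel

def pfNb (i m : ℕ) : List ℕ :=
  (List.range (pfN i)).filter fun k => !(m.testBit k) && (pfRow i k &&& m != 0)

def pfRest (i m : ℕ) : List ℕ :=
  (List.range (pfN i)).filter fun k => !(m.testBit k) && (pfRow i k &&& m == 0)

def pfGood (i m : ℕ) : Bool :=
  m == 0 || (pfRest i m).isEmpty || decide (3 < (pfNb i m).length) ||
  ((pfNb i m).length == 3 &&
    (pfNb i m).all (fun k => (pfNb i m).all fun l => !(pfAdj i k l)) &&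
    anyLt (pfN i) (fun v => ((pfNb i m).all fun k => pfAdj i v k) &&
      (allLt (pfN i) (fun k => m.testBit k == (k == v)) || pfRest i m == [v])))

lemma pfGood_all : allLt 7 (fun i => allLt (2 ^ pfN i) fun m => pfGood i m) = true := by
  decide +kernel

lemma pfAdj_symm_all : allLt 7 (fun i => allLt (pfN i) fun a => allLt (pfN i) fun b =>
    pfAdj i a b == pfAdj i b a) = true := by decide +kernel

lemma pfN_ge : allLt 7 (fun i => decide (6 ≤ pfN i)) = true := by decide +kernel

/-- `P` is (isomorphic to) the `i`-th graph of the list, via the labelling `e`. -/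
def PfRep {W : Type} (P : SimpleGraph W) : Prop :=
  ∃ i < 7, ∃ e : W → ℕ, Function.Injective e ∧ (∀ w, e w < pfN i) ∧
    (∀ k < pfN i, ∃ w, e w = k) ∧ ∀ u v, P.Adj u v ↔ pfAdj i (e u) (e v) = true

lemma triangleY_some_some {V : Type} (G : SimpleGraph V) (a b c u v : V) :
    (triangleY G a b c).Adj (some u) (some v) ↔
      G.Adj u v ∧ ¬ ((u = a ∨ u = b ∨ u = c) ∧ (v = a ∨ v = b ∨ v = c)) := by
  have hne : G.Adj u v → u ≠ v := fun h => h.ne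
  simp only [triangleY, SimpleGraph.sup_adj, SimpleGraph.map_adj, SimpleGraph.deleteEdges_adj,
    SimpleGraph.fromEdgeSet_adj]
  simp
  grind

lemma triangleY_none_some {V : Type} (G : SimpleGraph V) (a b c v : V) :
    (triangleY G a b c).Adj none (some v) ↔ (v = a ∨ v = b ∨ v = c) := by
  simp only [triangleY, SimpleGraph.sup_adj, SimpleGraph.map_adj, SimpleGraph.deleteEdges_adj,
    SimpleGraph.fromEdgeSet_adj]
  simp

lemma triangleY_some_none {V : Type} (G : SimpleGraph V) (a b c v : V) :
    (triangleY G a b c).Adj (some v) none ↔ (v = a ∨ v = b ∨ v = c) := by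
  rw [SimpleGraph.adj_comm, triangleY_none_some]

lemma pfRep_deltaY {V : Type} {G : SimpleGraph V} {a b c : V} (h : PfRep G)
    (hab : G.Adj a b) (hbc : G.Adj b c) (hac : G.Adj a c) : PfRep (triangleY G a b c) := by
  obtain ⟨i, hi, e, einj, elt, esurj, eadj⟩ := h
  have hc := complD_true
  simp only [complD, allLt_iff] at hc
  have h1 := hc i hi (e a) (elt a) (e b) (elt b)
  rw [eadj] at hab hbc hac
  simp only [hab, Bool.not_true, Bool.false_or, allLt_iff] at h1
  have h2 := h1 (e c) (elt c)
  simp only [hbc, hac, Bool.not_true, Bool.false_or, List.any_eq_true, Bool.and_eq_true,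
    allLt_iff, beq_iff_eq] at h2
  obtain ⟨⟨i', s, j, pl⟩, hr, hri, hs⟩ := h2
  have hok := List.all_eq_true.1 okD_all _ hr
  simp only at hri hs
  subst hri
  simp only [okD, Bool.and_eq_true, allLt_iff, anyLt_iff, decide_eq_true_eq, beq_iff_eq,
    Bool.or_eq_true, bne_iff_ne, Bool.not_eq_true'] at hok
  set p : ℕ → ℕ := fun k => pl.getD k 0 with hp
  obtain ⟨⟨⟨⟨hj, hn⟩, hbij⟩, hadj⟩, hirr⟩ := hok
  have hlt : ∀ w, e w < pfN i' + 1 := fun w => (elt w).trans (Nat.lt_succ_self _)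
  have hs' : ∀ u : V, s.testBit (e u) = true ↔ (u = a ∨ u = b ∨ u = c) := by
    intro u
    rw [hs _ (elt u)]
    simp [einj.eq_iff, or_assoc]
  have pinj : ∀ k < pfN i' + 1, ∀ l < pfN i' + 1, p k = p l → k = l := by
    intro k hk l hl hkl
    rcases (hbij k hk).2 l hl with h | h
    · exact h
    · exact absurd hkl h
  refine ⟨j, hj, fun o => p (o.elim (pfN i') e), ?_, ?_, ?_, ?_⟩
  · intro u v huv
    rcases u with _ | u <;> rcases v with _ | v
    · rfl
    · have := pinj _ (Nat.lt_succ_self _) _ (hlt v) huv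
      exact absurd (show pfN i' = e v from this) (elt v).ne'
    · have := pinj _ (hlt u) _ (Nat.lt_succ_self _) huv
      exact absurd (show e u = pfN i' from this) (elt u).ne
    · have := pinj _ (hlt u) _ (hlt v) huv
      rw [einj this]
  · intro o
    rw [hn]
    rcases o with _ | u
    · exact (hbij _ (Nat.lt_succ_self _)).1.1
    · exact (hbij _ (hlt u)).1.1
  · intro k hk
    rw [hn] at hk
    obtain ⟨l, hl, hlk⟩ := (hbij k hk).1.2
    rcases Nat.lt_succ_iff_lt_or_eq.1 hl with hl | hl
    · obtain ⟨w, hw⟩ := esurj l hl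
      exact ⟨some w, by simp only [Option.elim_some, hw]; exact hlk⟩
    · exact ⟨none, by subst hl; exact hlk⟩
  · intro u v
    rcases u with _ | u <;> rcases v with _ | v
    · simp only [SimpleGraph.irrefl, Option.elim_none, false_iff]
      rw [hirr]; simp
    · rw [triangleY_none_some, ← hs']
      simp only [Option.elim_none, Option.elim_some]
      rw [(hadj _ (elt v)).1.1]
    · rw [triangleY_some_none, ← hs']
      simp only [Option.elim_none, Option.elim_some]
      rw [(hadj _ (elt u)).1.2]
    · rw [triangleY_some_some, ← hs', ← hs', eadj]
      simp only [Option.elim_some]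
      rw [(hadj _ (elt u)).2 _ (elt v)]
      cases s.testBit (e u) <;> cases s.testBit (e v) <;> simp

lemma pfRep_yDelta {V : Type} {G : SimpleGraph V} {a b c : V} (h : PfRep (triangleY G a b c))
    (hab : G.Adj a b) (hbc : G.Adj b c) (hac : G.Adj a c) : PfRep G := by
  obtain ⟨j, hj, e, einj, elt, esurj, eadj⟩ := h
  have hc := complY_true
  simp only [complY, allLt_iff, Bool.or_eq_true, anyLt_iff, Bool.and_eq_true, bne_iff_ne,
    List.any_eq_true, beq_iff_eq] at hc
  rcases hc j hj (e none) (elt none) with h1 | h1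
  · obtain ⟨⟨j', v, i, ql⟩, hr, hrj, hv⟩ := h1
    have hok := List.all_eq_true.1 okY_all _ hr
    simp only at hrj hv
    subst hrj hv
    simp only [okY, Bool.and_eq_true, allLt_iff, anyLt_iff, decide_eq_true_eq, beq_iff_eq,
      Bool.or_eq_true, bne_iff_ne, Bool.not_eq_true'] at hok
    set q : ℕ → ℕ := fun k => ql.getD k 0 with hq
    obtain ⟨⟨hi, hmain⟩, hsurj⟩ := hok
    have hsn : ∀ u : V, e (some u) ≠ e none := fun u h => by simpa using einj h
    have hm : ∀ u, q (e (some u)) < pfN i ∧ ∀ w, (e (some u) = e (some w) ∨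
        q (e (some u)) ≠ q (e (some w))) ∧ pfAdj i (q (e (some u))) (q (e (some w))) =
          (pfAdj j' (e (some u)) (e (some w)) || (e (some u) != e (some w) &&
            pfAdj j' (e none) (e (some u)) && pfAdj j' (e none) (e (some w)))) := by
      intro u
      have h1 := (hmain _ (elt (some u))).resolve_left (hsn u)
      refine ⟨h1.1, fun w => ?_⟩
      exact (h1.2 _ (elt (some w))).resolve_left (hsn w)
    refine ⟨i, hi, fun u => q (e (some u)), ?_, fun u => (hm u).1, ?_, ?_⟩
    · intro u w huw
      rcases ((hm u).2 w).1 with h | h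
      · simpa using einj h
      · exact absurd huw h
    · intro t ht
      obtain ⟨k, hk, hkv, hkt⟩ := hsurj t ht
      obtain ⟨o, ho⟩ := esurj k hk
      rcases o with _ | w
      · exact absurd ho.symm hkv
      · exact ⟨w, by simp only [ho]; exact hkt⟩
    · intro u w
      rw [((hm u).2 w).2]
      simp only [Bool.or_eq_true, Bool.and_eq_true, bne_iff_ne, ← eadj, triangleY_some_some,
        triangleY_none_some, ne_eq, einj.eq_iff, Option.some.injEq]
      have h1 := hab.symm
      have h2 := hbc.symm
      have h3 := hac.symm
      constructor
      · intro h
        have := h.ne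
        tauto
      · rintro (h | ⟨⟨hne, hu⟩, hw⟩)
        · exact h.1
        · rcases hu with rfl | rfl | rfl <;> rcases hw with rfl | rfl | rfl <;> tauto
  · exfalso
    obtain ⟨k, hk, ⟨⟨hvk, ha⟩, hb⟩, hc⟩ :=
      h1 (e (some a)) (elt _) (e (some b)) (elt _) (e (some c)) (elt _)
    obtain ⟨o, ho⟩ := esurj k hk
    subst ho
    rw [← eadj] at hvk
    rcases o with _ | w
    · exact absurd hvk (SimpleGraph.irrefl _)
    · rw [triangleY_none_some] at hvk
      rcases hvk with rfl | rfl | rfl <;> simp_all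

lemma IsPetersenFamily.rep {W : Type} {P : SimpleGraph W} (h : IsPetersenFamily P) : PfRep P := by
  induction h with
  | k6 =>
    refine ⟨0, by norm_num, Fin.val, Fin.val_injective, fun w => w.2,
      fun k hk => ⟨⟨k, hk⟩, rfl⟩, ?_⟩
    decide
  | deltaY _ hab hbc hac ih => exact pfRep_deltaY ih hab hbc hac
  | yDelta _ hab hbc hac ih => exact pfRep_yDelta ih hab hbc hac
  | iso _ φ ih =>
    obtain ⟨i, hi, e, einj, elt, esurj, eadj⟩ := ih
    refine ⟨i, hi, fun w => e (φ.symm w), einj.comp φ.symm.injective, fun w => elt _, ?_, ?_⟩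
    · intro k hk
      obtain ⟨w, hw⟩ := esurj k hk
      exact ⟨φ w, by simpa using hw⟩
    · intro u v
      rw [← eadj]
      exact (φ.symm.map_adj_iff).symm

lemma PfRep.finite {W : Type} {P : SimpleGraph W} (h : PfRep P) : Finite W := by
  obtain ⟨i, hi, e, einj, elt, esurj, eadj⟩ := h
  exact Finite.of_injective (fun w => (⟨e w, elt w⟩ : Fin (pfN i))) fun u v huv =>
    einj (by simpa using huv)

lemma PfRep.card {W : Type} {P : SimpleGraph W} (h : PfRep P) : 6 ≤ Nat.card W := by
  have := h.finite
  obtain ⟨i, hi, e, einj, elt, esurj, eadj⟩ := h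
  have h6 : 6 ≤ pfN i := by simpa using allLt_iff.1 pfN_ge i hi
  have : Nat.card (Fin (pfN i)) ≤ Nat.card W :=
    Nat.card_le_card_of_surjective (fun w => (⟨e w, elt w⟩ : Fin (pfN i))) fun k => by
      obtain ⟨w, hw⟩ := esurj k k.2
      exact ⟨w, Fin.ext hw⟩
  simp at this
  omega

/-- Small separations of a Petersen family graph are trivial. -/
lemma PfRep.sep {W : Type} {P : SimpleGraph W} (h : PfRep P) (A B X : Set W)
    (hA : A.Nonempty) (hB : B.Nonempty) (hAB : Disjoint A B)
    (hX : X = (A ∪ B)ᶜ) (hedge : ∀ u ∈ A, ∀ v ∈ B, ¬ P.Adj u v) (hcard : X.ncard ≤ 3) :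
    ∃ v a b c, (A = {v} ∨ B = {v}) ∧ X = {a, b, c} ∧ a ≠ b ∧ b ≠ c ∧ a ≠ c ∧
      P.Adj v a ∧ P.Adj v b ∧ P.Adj v c ∧ ¬ P.Adj a b ∧ ¬ P.Adj b c ∧ ¬ P.Adj a c := by
  classical
  have hfin := h.finite
  obtain ⟨i, hi, e, einj, elt, esurj, eadj⟩ := h
  set m : ℕ := Nat.ofBits (fun k : Fin (pfN i) => decide (∃ w ∈ A, e w = k)) with hm
  have hmA : ∀ w, m.testBit (e w) = true ↔ w ∈ A := by
    intro w
    rw [hm, Nat.testBit_ofBits_lt _ _ (elt w)]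
    simp [einj.eq_iff]
  have hmlt : ∀ k, m.testBit k = true → ∃ w ∈ A, e w = k := by
    intro k hk
    by_cases hlt : k < pfN i
    · obtain ⟨w, rfl⟩ := esurj k hlt
      exact ⟨w, (hmA w).1 hk, rfl⟩
    · rw [hm, Nat.testBit_ofBits_ge _ _ (not_lt.1 hlt)] at hk
      simp at hk
  have hrow : ∀ w, (pfRow i (e w) &&& m) ≠ 0 ↔ ∃ u ∈ A, P.Adj w u := by
    intro w
    constructor
    · intro hne
      obtain ⟨k, hk⟩ := Nat.exists_testBit_of_ne_zero hne
      rw [Nat.testBit_and, Bool.and_eq_true] at hk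
      obtain ⟨u, hu, rfl⟩ := hmlt k hk.2
      exact ⟨u, hu, (eadj w u).2 hk.1⟩
    · rintro ⟨u, hu, hwu⟩ h0
      have : (pfRow i (e w) &&& m).testBit (e u) = true := by
        rw [Nat.testBit_and, Bool.and_eq_true]
        exact ⟨(eadj w u).1 hwu, (hmA u).2 hu⟩
      rw [h0] at this
      simp at this
  have hnb : ∀ w, e w ∈ pfNb i m ↔ w ∉ A ∧ ∃ u ∈ A, P.Adj w u := by
    intro w
    rw [← hrow, ← hmA]
    simp [pfNb, elt]
  have hrest : ∀ w, e w ∈ pfRest i m ↔ w ∉ A ∧ ¬ ∃ u ∈ A, P.Adj w u := by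
    intro w
    rw [← hrow, ← hmA]
    simp [pfRest, elt]
  have hnbX : ∀ k ∈ pfNb i m, ∃ w ∈ X, e w = k := by
    intro k hk
    have hlt : k < pfN i := by
      have := List.mem_filter.1 hk
      simpa using this.1
    obtain ⟨w, rfl⟩ := esurj k hlt
    refine ⟨w, ?_, rfl⟩
    obtain ⟨hwA, u, hu, hwu⟩ := (hnb w).1 hk
    rw [hX]
    rintro (h | h)
    · exact hwA h
    · exact hedge u hu w h hwu.symm
  have hnodup : (pfNb i m).Nodup := List.Nodup.filter _ List.nodup_range
  have hfX : (e '' X).Finite := Set.toFinite _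
  have hsub : (↑(pfNb i m).toFinset : Set ℕ) ⊆ e '' X := by
    intro k hk
    simp only [List.coe_toFinset, Set.mem_ofPred_eq] at hk
    obtain ⟨w, hw, rfl⟩ := hnbX k hk
    exact ⟨w, hw, rfl⟩
  have hcardX : (e '' X).ncard = X.ncard := Set.ncard_image_of_injective _ einj
  have hlenc : (↑(pfNb i m).toFinset : Set ℕ).ncard = (pfNb i m).length := by
    rw [Set.ncard_coe_finset, List.toFinset_card_of_nodup hnodup]
  have hlen : (pfNb i m).length ≤ X.ncard := by
    rw [← hlenc, ← hcardX]
    exact Set.ncard_le_ncard hsub hfX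
  have hgood := allLt_iff.1 (allLt_iff.1 pfGood_all i hi) m (Nat.ofBits_lt_two_pow _)
  have hm0 : m ≠ 0 := by
    obtain ⟨w, hw⟩ := hA
    intro h0
    have := (hmA w).2 hw
    rw [h0] at this
    simp at this
  have hBrest : ∀ w ∈ B, e w ∈ pfRest i m := by
    intro w hw
    rw [hrest]
    refine ⟨fun h => Set.disjoint_left.1 hAB h hw, ?_⟩
    rintro ⟨u, hu, hwu⟩
    exact hedge u hu w hw hwu.symm
  have hr0 : pfRest i m ≠ [] := by
    obtain ⟨w, hw⟩ := hB
    exact List.ne_nil_of_mem (hBrest w hw)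
  simp only [pfGood, Bool.or_eq_true, Bool.and_eq_true, beq_iff_eq, List.isEmpty_iff,
    decide_eq_true_eq, List.all_eq_true, anyLt_iff, allLt_iff, Bool.not_eq_true'] at hgood
  rcases hgood with ((hg | hg) | hg) | hg
  · exact absurd hg hm0
  · exact absurd hg hr0
  · omega
  obtain ⟨⟨hl3, hind⟩, v, hv, hvall, hcase⟩ := hg
  have heq : (↑(pfNb i m).toFinset : Set ℕ) = e '' X := by
    apply Set.eq_of_subset_of_ncard_le hsub _ hfX
    rw [hlenc, hcardX]
    omega
  have hXnb : ∀ w, w ∈ X ↔ e w ∈ pfNb i m := by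
    intro w
    have : e w ∈ (↑(pfNb i m).toFinset : Set ℕ) ↔ e w ∈ e '' X := by rw [heq]
    rw [einj.mem_set_image] at this
    rw [← this]
    simp
  obtain ⟨k1, k2, k3, hk⟩ := List.length_eq_three.1 hl3
  rw [hk] at hnodup hXnb hind hvall hnbX
  obtain ⟨a, ha, rfl⟩ := hnbX k1 (by simp)
  obtain ⟨b, hb, rfl⟩ := hnbX k2 (by simp)
  obtain ⟨c, hc, rfl⟩ := hnbX k3 (by simp)
  obtain ⟨v, rfl⟩ := esurj v hv
  simp only [List.nodup_cons, List.mem_cons, List.not_mem_nil, or_false, not_or,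
    einj.eq_iff] at hnodup
  refine ⟨v, a, b, c, ?_, ?_, hnodup.1.1, hnodup.2.1, hnodup.1.2, ?_, ?_, ?_, ?_, ?_, ?_⟩
  · rcases hcase with hcase | hcase
    · left
      ext w
      rw [← hmA, hcase _ (elt w)]
      simp [einj.eq_iff]
    · right
      have : ∀ w ∈ B, w = v := by
        intro w hw
        have := hBrest w hw
        rw [hcase] at this
        exact einj (by simpa using this)
      obtain ⟨w, hw⟩ := hB
      ext u
      constructor
      · exact this u
      · rintro rfl
        rwa [← this w hw]
  · ext w
    rw [hXnb]
    simp [einj.eq_iff]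
  · exact (eadj _ _).2 (hvall _ (by simp))
  · exact (eadj _ _).2 (hvall _ (by simp))
  · exact (eadj _ _).2 (hvall _ (by simp))
  · rw [eadj, hind _ (by simp) _ (by simp)]; simp
  · rw [eadj, hind _ (by simp) _ (by simp)]; simp
  · rw [eadj, hind _ (by simp) _ (by simp)]; simp

/-- The `Y∇`-move at a degree-three vertex. -/
def yTri {W : Type} (P : SimpleGraph W) (v : W) : SimpleGraph {w : W // w ≠ v} where
  Adj u w := P.Adj u.1 w.1 ∨ (u ≠ w ∧ P.Adj v u.1 ∧ P.Adj v w.1)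
  symm := ⟨fun _ _ h => h.elim (fun h => Or.inl h.symm) fun h => Or.inr ⟨h.1.symm, h.2.2, h.2.1⟩⟩
  loopless := ⟨fun _ h => h.elim (fun h => h.ne rfl) fun h => h.1 rfl⟩

lemma yTri_petersen {W : Type} {P : SimpleGraph W} (hP : IsPetersenFamily P) {v a b c : W}
    (hab : a ≠ b) (hbc : b ≠ c) (hac : a ≠ c) (hN : ∀ w, P.Adj v w ↔ (w = a ∨ w = b ∨ w = c))
    (nab : ¬ P.Adj a b) (nbc : ¬ P.Adj b c) (nac : ¬ P.Adj a c) :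
    IsPetersenFamily (yTri P v) := by
  classical
  have va : P.Adj v a := (hN a).2 (by simp)
  have vb : P.Adj v b := (hN b).2 (by simp)
  have vc : P.Adj v c := (hN c).2 (by simp)
  have ha : a ≠ v := va.ne'
  have hb : b ≠ v := vb.ne'
  have hc : c ≠ v := vc.ne'
  have nba : ¬ P.Adj b a := fun h => nab h.symm
  have ncb : ¬ P.Adj c b := fun h => nbc h.symm
  have nca : ¬ P.Adj c a := fun h => nac h.symm
  refine IsPetersenFamily.yDelta (a := ⟨a, ha⟩) (b := ⟨b, hb⟩) (c := ⟨c, hc⟩)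
    (IsPetersenFamily.iso hP ?_) (Or.inr ⟨by simpa using hab, va, vb⟩)
    (Or.inr ⟨by simpa using hbc, vb, vc⟩) (Or.inr ⟨by simpa using hac, va, vc⟩)
  refine SimpleGraph.Iso.symm ?_
  refine ⟨Equiv.optionSubtypeNe v, ?_⟩
  intro u w
  rcases u with _ | ⟨u, hu⟩ <;> rcases w with _ | ⟨w, hw⟩
  · simp
  · rw [triangleY_none_some]
    simp [hN]
  · rw [triangleY_some_none]
    simp [P.adj_comm u v, hN]
  · rw [triangleY_some_some]
    simp only [yTri, hN]
    simp only [Equiv.optionSubtypeNe_some, ne_eq, Subtype.mk.injEq]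
    constructor
    · intro h
      refine ⟨Or.inl h, ?_⟩
      rintro ⟨rfl | rfl | rfl, rfl | rfl | rfl⟩ <;>
        first | exact absurd h (SimpleGraph.irrefl _) | contradiction
    · tauto

/-- Connectedness of a vertex set, in terms of cuts. -/
def Conn {V : Type} (G : SimpleGraph V) (A : Set V) : Prop :=
  A.Nonempty ∧ ∀ C ⊆ A, C.Nonempty → (∀ u ∈ C, ∀ v ∈ A, G.Adj u v → v ∈ C) → A ⊆ C

lemma conn_iff {V : Type} {G : SimpleGraph V} {A : Set V} :
    (G.induce A).Connected ↔ Conn G A := by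
  constructor
  · intro h
    obtain ⟨⟨a, ha⟩⟩ := h.nonempty
    refine ⟨⟨a, ha⟩, ?_⟩
    rintro C hCA ⟨c, hc⟩ hcl v hv
    obtain ⟨p⟩ := h.preconnected ⟨c, hCA hc⟩ ⟨v, hv⟩
    have key : ∀ (s t : A), (G.induce A).Walk s t → s.1 ∈ C → t.1 ∈ C := by
      intro s t p
      induction p with
      | nil => exact id
      | cons hadj _ ih => exact fun hs => ih (hcl _ hs _ (Subtype.property _) hadj)
    exact key _ _ p hc
  · rintro ⟨⟨a, ha⟩, h⟩
    have hn : Nonempty A := ⟨⟨a, ha⟩⟩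
    refine ⟨?_⟩
    rintro ⟨u, hu⟩ ⟨v, hv⟩
    have := h {w | ∃ hw : w ∈ A, (G.induce A).Reachable ⟨u, hu⟩ ⟨w, hw⟩} (fun w hw => hw.1)
      ⟨u, hu, SimpleGraph.Reachable.refl _⟩ ?_ hv
    · exact this.2
    · rintro s ⟨hs, hr⟩ t ht hst
      refine ⟨ht, hr.trans (SimpleGraph.Adj.reachable ?_)⟩
      exact hst

/-- `H` is a minor of `G` with branch sets inside `S`. -/
def MinorIn {W V : Type} (H : SimpleGraph W) (G : SimpleGraph V) (S : Set V) : Prop :=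
  ∃ f : W → Set V, (∀ w, f w ⊆ S) ∧ (∀ w, Conn G (f w)) ∧
    (∀ w₁ w₂, w₁ ≠ w₂ → Disjoint (f w₁) (f w₂)) ∧
    ∀ w₁ w₂, H.Adj w₁ w₂ → ∃ v₁ ∈ f w₁, ∃ v₂ ∈ f w₂, G.Adj v₁ v₂

def Lk {V : Type} (G : SimpleGraph V) (S : Set V) : Prop :=
  ∀ ⦃W : Type⦄ (P : SimpleGraph W), IsPetersenFamily P → ¬ MinorIn P G S

lemma conn_image {V : Type} {G : SimpleGraph V} {S : Set V} {A : Set S} :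
    Conn (G.induce S) A ↔ Conn G (Subtype.val '' A) := by
  constructor
  · rintro ⟨hne, h⟩
    refine ⟨hne.image _, ?_⟩
    rintro C hC ⟨c, hc⟩ hcl
    have hAC : A ⊆ Subtype.val ⁻¹' C := by
      have hinter : A ⊆ A ∩ (Subtype.val ⁻¹' C) := by
        apply h _ Set.inter_subset_left
        · obtain ⟨s, hs, rfl⟩ := hC hc
          exact ⟨s, hs, hc⟩
        · rintro u ⟨huA, huC⟩ v hv huv
          exact ⟨hv, hcl _ huC _ ⟨v, hv, rfl⟩ huv⟩
      exact fun s hs => (hinter hs).2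
    rintro _ ⟨s, hs, rfl⟩
    exact hAC hs
  · rintro ⟨hne, h⟩
    refine ⟨hne.of_image, ?_⟩
    rintro C hC hCne hcl
    have := h (Subtype.val '' C) (Set.image_mono hC) (hCne.image _) ?_
    · intro s hs
      obtain ⟨t, ht, hts⟩ := this ⟨s, hs, rfl⟩
      rwa [← Subtype.ext hts]
    · rintro _ ⟨u, hu, rfl⟩ _ ⟨v, hv, rfl⟩ huv
      exact ⟨v, hcl u hu v hv huv, rfl⟩

lemma isMinor_iff {W V : Type} {H : SimpleGraph W} {G : SimpleGraph V} :
    IsMinor H G ↔ MinorIn H G Set.univ := by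
  constructor
  · rintro ⟨f, _, hc, hd, ha⟩
    exact ⟨f, fun w => Set.subset_univ _, fun w => conn_iff.1 (hc w), fun _ _ h => hd h,
      fun _ _ h => ha h⟩
  · rintro ⟨f, _, hc, hd, ha⟩
    exact ⟨f, fun w => (hc w).1, fun w => conn_iff.2 (hc w), fun _ _ h => hd _ _ h,
      fun _ _ h => ha _ _ h⟩

lemma isMinor_induce_iff {W V : Type} {H : SimpleGraph W} {G : SimpleGraph V} {S : Set V} :
    IsMinor H (G.induce S) ↔ MinorIn H G S := by
  rw [isMinor_iff]
  constructor
  · rintro ⟨f, _, hc, hd, ha⟩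
    refine ⟨fun w => Subtype.val '' f w, ?_, fun w => conn_image.1 (hc w), ?_, ?_⟩
    · rintro w _ ⟨s, _, rfl⟩
      exact s.2
    · intro w₁ w₂ hne
      exact (Set.disjoint_image_iff Subtype.val_injective).2 (hd _ _ hne)
    · intro w₁ w₂ hw
      obtain ⟨u, hu, v, hv, huv⟩ := ha _ _ hw
      exact ⟨u, ⟨u, hu, rfl⟩, v, ⟨v, hv, rfl⟩, huv⟩
  · rintro ⟨f, hs, hc, hd, ha⟩
    have him : ∀ w, Subtype.val '' (Subtype.val ⁻¹' f w : Set S) = f w := by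
      intro w
      rw [Subtype.image_preimage_coe]
      exact Set.inter_eq_right.2 (hs w)
    refine ⟨fun w => Subtype.val ⁻¹' f w, fun _ => Set.subset_univ _, ?_, ?_, ?_⟩
    · intro w
      rw [conn_image, him]
      exact hc w
    · intro w₁ w₂ hne
      exact (hd _ _ hne).preimage _
    · intro w₁ w₂ hw
      obtain ⟨u, hu, v, hv, huv⟩ := ha _ _ hw
      exact ⟨⟨u, hs _ hu⟩, hu, ⟨v, hs _ hv⟩, hv, huv⟩

lemma isLinkless_iff {V : Type} {G : SimpleGraph V} : IsLinkless G ↔ Lk G Set.univ := by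
  simp only [IsLinkless, Lk, isMinor_iff]

lemma isLinkless_induce_iff {V : Type} {G : SimpleGraph V} {S : Set V} :
    IsLinkless (G.induce S) ↔ Lk G S := by
  simp only [IsLinkless, Lk, isMinor_induce_iff]

lemma addEdge_adj {V : Type} {G : SimpleGraph V} {a b u v : V} :
    (addEdge G a b).Adj u v ↔
      G.Adj u v ∨ (u ≠ v ∧ ((u = a ∧ v = b) ∨ (u = b ∧ v = a))) := by
  simp only [addEdge, SimpleGraph.sup_adj, SimpleGraph.fromEdgeSet_adj, Set.mem_singleton_iff,
    Sym2.eq_iff]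
  tauto

lemma addEdge_induce {V : Type} {G : SimpleGraph V} {S : Set V} (a b : S) :
    addEdge (G.induce S) a b = (addEdge G a.1 b.1).induce S := by
  ext u v
  simp only [addEdge_adj, SimpleGraph.comap_adj, Function.Embedding.subtype_apply, ne_eq,
    Subtype.ext_iff]

lemma Lk.mono {V : Type} {G : SimpleGraph V} {S T : Set V} (h : Lk G T) (hST : S ⊆ T) :
    Lk G S := by
  rintro W P hP ⟨f, hs, hr⟩
  exact h P hP ⟨f, fun w => (hs w).trans hST, hr⟩

lemma Conn.congr {V : Type} {G H : SimpleGraph V} {S A : Set V} (hA : A ⊆ S)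
    (hGH : ∀ u ∈ S, ∀ v ∈ S, G.Adj u v → H.Adj u v) (h : Conn G A) : Conn H A :=
  ⟨h.1, fun C hC hne hcl => h.2 C hC hne fun u hu v hv huv =>
    hcl u hu v hv (hGH u (hA (hC hu)) v (hA hv) huv)⟩

lemma Lk.congr {V : Type} {G H : SimpleGraph V} {S : Set V} (h : Lk H S)
    (hGH : ∀ u ∈ S, ∀ v ∈ S, G.Adj u v → H.Adj u v) : Lk G S := by
  rintro W P hP ⟨f, hs, hc, hd, ha⟩
  refine h P hP ⟨f, hs, fun w => (hc w).congr (hs w) hGH, hd, fun w₁ w₂ hw => ?_⟩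
  obtain ⟨u, hu, v, hv, huv⟩ := ha _ _ hw
  exact ⟨u, hu, v, hv, hGH _ (hs _ hu) _ (hs _ hv) huv⟩

lemma Lk.of_card {V : Type} [Finite V] {G : SimpleGraph V} {S : Set V} (h : S.ncard ≤ 5) :
    Lk G S := by
  rintro W P hP ⟨f, hs, hc, hd, ha⟩
  have hf := hP.rep.finite
  have h6 := hP.rep.card
  choose g hg using fun w => (hc w).1
  have ginj : Function.Injective (fun w => (⟨g w, hs w (hg w)⟩ : S)) := by
    intro u w huw
    by_contra hne
    have huw' : g u = g w := by simpa using huw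
    exact Set.disjoint_left.1 (hd u w hne) (hg u) (huw' ▸ hg w)
  have := Nat.card_le_card_of_injective _ ginj
  rw [Nat.card_coe_set_eq] at this
  omega

/-- `S₁ ∪ S₂` is a clique sum (over at most three vertices) inside `G`. -/
structure CSum {V : Type} (G : SimpleGraph V) (S₁ S₂ : Set V) : Prop where
  clique : ∀ u ∈ S₁ ∩ S₂, ∀ v ∈ S₁ ∩ S₂, u ≠ v → G.Adj u v
  edge : ∀ u ∈ S₁, ∀ v ∈ S₂, G.Adj u v → u ∈ S₂ ∨ v ∈ S₁

lemma CSum.symm {V : Type} {G : SimpleGraph V} {S₁ S₂ : Set V} (h : CSum G S₁ S₂) :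
    CSum G S₂ S₁ :=
  ⟨fun u hu v hv => h.clique u hu.symm v hv.symm,
    fun u hu v hv huv => (h.edge v hv u hu huv.symm).symm⟩

lemma CSum.conn {V : Type} {G : SimpleGraph V} {S₁ S₂ A : Set V} (h : CSum G S₁ S₂)
    (hA : A ⊆ S₁ ∪ S₂) (hc : Conn G A) (hne : (A ∩ S₂).Nonempty) : Conn G (A ∩ S₂) := by
  refine ⟨hne, ?_⟩
  intro C hC hCne hcl
  have hD : A ⊆ C ∪ {w | w ∈ A ∧ w ∉ S₂ ∧ ∃ t ∈ C, t ∈ S₁} := by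
    apply hc.2
    · rintro w (hw | hw)
      · exact (hC hw).1
      · exact hw.1
    · exact hCne.mono Set.subset_union_left
    · rintro u (hu | ⟨huA, hu2, t, htC, ht1⟩) v hv huv
      · by_cases hv2 : v ∈ S₂
        · exact Or.inl (hcl u hu v ⟨hv, hv2⟩ huv)
        · have hv1 : v ∈ S₁ := (hA hv).resolve_right hv2
          refine Or.inr ⟨hv, hv2, u, hu, ?_⟩
          rcases h.edge v hv1 u (hC hu).2 huv.symm with h' | h'
          · exact absurd h' hv2
          · exact h'
      · by_cases hv2 : v ∈ S₂
        · left
          have hu1 : u ∈ S₁ := (hA huA).resolve_right hu2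
          have hv1 : v ∈ S₁ := (h.edge u hu1 v hv2 huv).resolve_left hu2
          by_cases htv : t = v
          · exact htv ▸ htC
          · exact hcl t htC v ⟨hv, hv2⟩
              (h.clique t ⟨ht1, (hC htC).2⟩ v ⟨hv1, hv2⟩ htv)
        · exact Or.inr ⟨hv, hv2, t, htC, ht1⟩
  rintro w ⟨hwA, hw2⟩
  rcases hD hwA with hw | hw
  · exact hw
  · exact absurd hw2 hw.2.1

/-- A connected set that meets both sides of a clique sum meets the clique. -/
lemma CSum.hit {V : Type} {G : SimpleGraph V} {S₁ S₂ A : Set V} (h : CSum G S₁ S₂)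
    (hA : A ⊆ S₁ ∪ S₂) (hc : Conn G A) (h1 : (A ∩ S₁).Nonempty) (h2 : (A ∩ S₂).Nonempty) :
    (A ∩ (S₁ ∩ S₂)).Nonempty := by
  by_contra hno
  rw [Set.not_nonempty_iff_eq_empty] at hno
  have hno' : ∀ w ∈ A, w ∈ S₁ → w ∉ S₂ := by
    intro w hw hw1 hw2
    have : w ∈ A ∩ (S₁ ∩ S₂) := ⟨hw, hw1, hw2⟩
    rw [hno] at this
    exact this
  have := hc.2 (A ∩ S₁) Set.inter_subset_left h1 ?_
  · obtain ⟨w, hw, hw2⟩ := h2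
    exact hno' w hw (this hw).2 hw2
  · rintro u ⟨hu, hu1⟩ v hv huv
    refine ⟨hv, ?_⟩
    by_contra hv1
    have hv2 := (hA hv).resolve_left hv1
    rcases h.edge u hu1 v hv2 huv with h' | h'
    · exact hno' u hu hu1 h'
    · exact hv1 h'

/-- Restriction of a minor to one side of a clique sum. -/
lemma CSum.restrict {V W W' : Type} {G : SimpleGraph V} {S₁ S₂ : Set V} (h : CSum G S₁ S₂)
    {P : SimpleGraph W} (f : W → Set V) (hs : ∀ w, f w ⊆ S₁ ∪ S₂) (hc : ∀ w, Conn G (f w))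
    (hd : ∀ w₁ w₂, w₁ ≠ w₂ → Disjoint (f w₁) (f w₂))
    (ha : ∀ w₁ w₂, P.Adj w₁ w₂ → ∃ v₁ ∈ f w₁, ∃ v₂ ∈ f w₂, G.Adj v₁ v₂)
    (P' : SimpleGraph W') (g : W' → W) (hg : Function.Injective g)
    (hne : ∀ w, (f (g w) ∩ S₂).Nonempty)
    (hP' : ∀ u w, P'.Adj u w → P.Adj (g u) (g w) ∨
      ((f (g u) ∩ (S₁ ∩ S₂)).Nonempty ∧ (f (g w) ∩ (S₁ ∩ S₂)).Nonempty)) :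
    MinorIn P' G S₂ := by
  refine ⟨fun w => f (g w) ∩ S₂, fun w => Set.inter_subset_right,
    fun w => h.conn (hs _) (hc _) (hne w), ?_, ?_⟩
  · intro u w huw
    exact (hd _ _ (hg.ne huw)).mono Set.inter_subset_left Set.inter_subset_left
  · intro u w huw
    have key : (f (g u) ∩ (S₁ ∩ S₂)).Nonempty → (f (g w) ∩ (S₁ ∩ S₂)).Nonempty →
        ∃ v₁ ∈ f (g u) ∩ S₂, ∃ v₂ ∈ f (g w) ∩ S₂, G.Adj v₁ v₂ := by
      rintro ⟨s, hs1, hs2⟩ ⟨t, ht1, ht2⟩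
      refine ⟨s, ⟨hs1, hs2.2⟩, t, ⟨ht1, ht2.2⟩, h.clique s hs2 t ht2 ?_⟩
      rintro rfl
      exact Set.disjoint_left.1 (hd _ _ (hg.ne huw.ne)) hs1 ht1
    rcases hP' u w huw with hadj | ⟨h1, h2⟩
    · obtain ⟨s, hsu, t, htw, hst⟩ := ha _ _ hadj
      by_cases hs2 : s ∈ S₂ <;> by_cases ht2 : t ∈ S₂
      · exact ⟨s, ⟨hsu, hs2⟩, t, ⟨htw, ht2⟩, hst⟩
      · have ht1 := (hs _ htw).resolve_right ht2
        have hs1 := (h.edge t ht1 s hs2 hst.symm).resolve_left ht2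
        exact key ⟨s, hsu, hs1, hs2⟩ (h.hit (hs _) (hc _) ⟨t, htw, ht1⟩ (hne w))
      · have hs1 := (hs _ hsu).resolve_right hs2
        have ht1 := (h.edge s hs1 t ht2 hst).resolve_left hs2
        exact key (h.hit (hs _) (hc _) ⟨s, hsu, hs1⟩ (hne u)) ⟨t, htw, ht1, ht2⟩
      · exact key (h.hit (hs _) (hc _) ⟨s, hsu, (hs _ hsu).resolve_right hs2⟩ (hne u))
          (h.hit (hs _) (hc _) ⟨t, htw, (hs _ htw).resolve_right ht2⟩ (hne w))
    · exact key h1 h2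

/-- The case of a clique sum where a single branch set avoids the side `S₂`. -/
lemma CSum.single {V W : Type} {G : SimpleGraph V} {S₁ S₂ : Set V} (h : CSum G S₁ S₂)
    {P : SimpleGraph W} (hP : IsPetersenFamily P)
    (f : W → Set V) (hs : ∀ w, f w ⊆ S₁ ∪ S₂) (hc : ∀ w, Conn G (f w))
    (hd : ∀ w₁ w₂, w₁ ≠ w₂ → Disjoint (f w₁) (f w₂))
    (ha : ∀ w₁ w₂, P.Adj w₁ w₂ → ∃ v₁ ∈ f w₁, ∃ v₂ ∈ f w₂, G.Adj v₁ v₂)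
    {v a b c : W} (hA : ∀ w, w ≠ v → (f w ∩ S₂).Nonempty)
    (hX : ∀ w, (w = a ∨ w = b ∨ w = c) → (f w ∩ (S₁ ∩ S₂)).Nonempty)
    (hab : a ≠ b) (hbc : b ≠ c) (hac : a ≠ c) (hN : ∀ w, P.Adj v w ↔ (w = a ∨ w = b ∨ w = c))
    (nab : ¬ P.Adj a b) (nbc : ¬ P.Adj b c) (nac : ¬ P.Adj a c) : ¬ Lk G S₂ := by
  intro hL
  refine hL (yTri P v) (yTri_petersen hP hab hbc hac hN nab nbc nac) ?_
  refine h.restrict f hs hc hd ha _ Subtype.val Subtype.val_injective (fun w => hA _ w.2) ?_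
  rintro u w (huw | ⟨_, hu, hw⟩)
  · exact Or.inl huw
  · exact Or.inr ⟨hX _ ((hN _).1 hu), hX _ ((hN _).1 hw)⟩

/-- Clique sums over at most three vertices preserve linklessness. -/
lemma CSum.lk {V : Type} [Finite V] {G : SimpleGraph V} {S₁ S₂ : Set V} (h : CSum G S₁ S₂)
    (hcard : (S₁ ∩ S₂).ncard ≤ 3) (h1 : Lk G S₁) (h2 : Lk G S₂) : Lk G (S₁ ∪ S₂) := by
  rintro W P hP ⟨f, hs, hc, hd, ha⟩
  have hs' : ∀ w, f w ⊆ S₂ ∪ S₁ := fun w => by rw [Set.union_comm]; exact hs w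
  by_cases hA : ∀ w, (f w ∩ S₂).Nonempty
  · exact h2 P hP (h.restrict f hs hc hd ha P id Function.injective_id hA fun u w huw => Or.inl huw)
  by_cases hB : ∀ w, (f w ∩ S₁).Nonempty
  · exact h1 P hP
      (h.symm.restrict f hs' hc hd ha P id Function.injective_id hB fun u w huw => Or.inl huw)
  push Not at hA hB
  have hfin := hP.rep.finite
  set A : Set W := {w | ¬ (f w ∩ S₂).Nonempty} with hAdef
  set B : Set W := {w | ¬ (f w ∩ S₁).Nonempty} with hBdef
  have hone : ∀ w, (f w ∩ S₁).Nonempty ∨ (f w ∩ S₂).Nonempty := by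
    intro w
    obtain ⟨t, ht⟩ := (hc w).1
    rcases hs w ht with h' | h'
    · exact Or.inl ⟨t, ht, h'⟩
    · exact Or.inr ⟨t, ht, h'⟩
  have hXT : ∀ w, w ∈ (A ∪ B)ᶜ → (f w ∩ (S₁ ∩ S₂)).Nonempty := by
    intro w hw
    simp only [hAdef, hBdef, Set.mem_compl_iff, Set.mem_union, Set.mem_ofPred_eq, not_or,
      not_not] at hw
    exact h.hit (hs w) (hc w) hw.2 hw.1
  have hXcard : (A ∪ B)ᶜ.ncard ≤ 3 := by
    refine le_trans ?_ hcard
    have hVne : Nonempty V := ⟨(hc hA.choose).1.some⟩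
    choose! g hg using hXT
    apply Set.ncard_le_ncard_of_injOn g (fun w hw => (hg w hw).2)
    intro u hu w hw huw
    by_contra hne
    exact Set.disjoint_left.1 (hd u w hne) (hg u hu).1 (huw ▸ (hg w hw).1)
  have hAB : Disjoint A B := by
    rw [Set.disjoint_left]
    intro w hwA hwB
    exact (hone w).elim hwB hwA
  have hedge : ∀ u ∈ A, ∀ v ∈ B, ¬ P.Adj u v := by
    intro u hu v hv huv
    obtain ⟨s, hsu, t, htv, hst⟩ := ha _ _ huv
    have hs2 : s ∉ S₂ := fun h' => hu ⟨s, hsu, h'⟩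
    have ht1 : t ∉ S₁ := fun h' => hv ⟨t, htv, h'⟩
    rcases h.edge s ((hs _ hsu).resolve_right hs2) t ((hs _ htv).resolve_left ht1) hst with h' | h'
    · exact hs2 h'
    · exact ht1 h'
  have hAne : A.Nonempty := by
    obtain ⟨w, hw⟩ := hA
    exact ⟨w, by simp [hAdef, hw]⟩
  have hBne : B.Nonempty := by
    obtain ⟨w, hw⟩ := hB
    exact ⟨w, by simp [hBdef, hw]⟩
  obtain ⟨v, a, b, c, hv, hX, hab, hbc, hac, va, vb, vc, nab, nbc, nac⟩ :=
    hP.rep.sep A B _ hAne hBne hAB rfl hedge hXcard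
  have hXmem : ∀ w, (w = a ∨ w = b ∨ w = c) ↔ w ∉ A ∧ w ∉ B := by
    intro w
    have : w ∈ (A ∪ B)ᶜ ↔ w ∈ ({a, b, c} : Set W) := by rw [hX]
    simpa [not_or] using this.symm
  have hX2 : ∀ w, (w = a ∨ w = b ∨ w = c) → (f w ∩ (S₁ ∩ S₂)).Nonempty := by
    intro w hw
    apply hXT
    rw [hX]
    exact hw
  have hNr : ∀ w, (w = a ∨ w = b ∨ w = c) → P.Adj v w := by
    rintro w (rfl | rfl | rfl) <;> assumption
  rcases hv with hv | hv
  · refine h.single hP f hs hc hd ha (v := v) ?_ hX2 hab hbc hac ?_ nab nbc nac h2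
    · intro w hw
      by_contra hcon
      have : w ∈ A := hcon
      rw [hv] at this
      exact hw this
    · intro w
      refine ⟨fun hvw => (hXmem w).2 ⟨?_, ?_⟩, hNr w⟩
      · rw [hv]
        exact hvw.ne'
      · intro hwB
        exact hedge v (by rw [hv]; rfl) w hwB hvw
  · refine h.symm.single hP f hs' hc hd ha (v := v) ?_ ?_ hab hbc hac ?_ nab nbc nac h1
    · intro w hw
      by_contra hcon
      have : w ∈ B := hcon
      rw [hv] at this
      exact hw this
    · intro w hw
      rw [Set.inter_comm S₂ S₁]
      exact hX2 w hw
    · intro w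
      refine ⟨fun hvw => (hXmem w).2 ⟨?_, ?_⟩, hNr w⟩
      · intro hwA
        exact hedge w hwA v (by rw [hv]; rfl) hvw.symm
      · rw [hv]
        exact hvw.ne'

lemma ncard_le_three {V : Type} {T : Set V} {p q r : V} (h : T ⊆ {p, q, r}) : T.ncard ≤ 3 := by
  refine (Set.ncard_le_ncard h (Set.toFinite _)).trans ?_
  refine (Set.ncard_insert_le _ _).trans ?_
  have := Set.ncard_insert_le q {r}
  rw [Set.ncard_singleton] at this
  omega

lemma ncard_le_four {V : Type} {p q r s : V} : ({p, q, r, s} : Set V).ncard ≤ 4 := by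
  refine (Set.ncard_insert_le _ _).trans ?_
  have := ncard_le_three (T := {q, r, s}) (p := q) (q := r) (r := s) subset_rfl
  omega

/-- Maximal linklessness relative to a vertex set. -/
lemma maxnil_induce {V : Type} {G : SimpleGraph V} {S : Set V} (h : IsMaxnil (G.induce S)) :
    Lk G S ∧ ∀ a ∈ S, ∀ b ∈ S, a ≠ b → ¬ G.Adj a b → ¬ Lk (addEdge G a b) S := by
  refine ⟨isLinkless_induce_iff.1 h.1, ?_⟩
  intro a ha b hb hab hadj hL
  refine h.2 ⟨a, ha⟩ ⟨b, hb⟩ (by simpa using hab) hadj ?_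
  rw [addEdge_induce]
  exact isLinkless_induce_iff.2 hL

lemma addEdge_lk {V : Type} {G : SimpleGraph V} {S : Set V} {a b : V} (h : Lk G S)
    (hab : a ∉ S ∨ b ∉ S) : Lk (addEdge G a b) S := by
  refine h.congr ?_
  intro u hu v hv huv
  rw [addEdge_adj] at huv
  rcases huv with huv | ⟨_, ⟨rfl, rfl⟩ | ⟨rfl, rfl⟩⟩
  · exact huv
  · tauto
  · tauto

lemma maxnil_connected {V : Type} [Finite V] {G : SimpleGraph V} {S C : Set V}
    (h : IsMaxnil (G.induce S)) (hC : C ⊆ S) (hne : C.Nonempty)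
    (hcl : ∀ u ∈ C, ∀ v ∈ S, G.Adj u v → v ∈ C) : S ⊆ C := by
  intro d hd
  by_contra hdC
  obtain ⟨c, hc⟩ := hne
  obtain ⟨hL, hmax⟩ := maxnil_induce h
  have hcd : c ≠ d := fun h' => hdC (h' ▸ hc)
  refine hmax c (hC hc) d hd hcd (fun h' => hdC (hcl c hc d hd h')) ?_
  have hCL : Lk (addEdge G c d) C := addEdge_lk (hL.mono hC) (Or.inr hdC)
  have hDL : Lk (addEdge G c d) (S \ C) :=
    addEdge_lk (hL.mono Set.diff_subset) (Or.inl fun h' => h'.2 hc)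
  have s1 : CSum (addEdge G c d) C {c, d} := by
    constructor
    · simp only [Set.mem_inter_iff, Set.mem_insert_iff, Set.mem_singleton_iff]
      grind
    · simp only [Set.mem_insert_iff, Set.mem_singleton_iff, addEdge_adj]
      grind
  have l1 := s1.lk (ncard_le_three (p := c) (q := d) (r := d) (by grind)) hCL
    (Lk.of_card ((ncard_le_three (p := c) (q := d) (r := d) (by grind)).trans (by norm_num)))
  have s2 : CSum (addEdge G c d) (C ∪ {c, d}) (S \ C) := by
    constructor
    · simp only [Set.mem_inter_iff, Set.mem_insert_iff, Set.mem_singleton_iff, Set.mem_union,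
        Set.mem_diff]
      grind
    · simp only [Set.mem_insert_iff, Set.mem_singleton_iff, addEdge_adj, Set.mem_union,
        Set.mem_diff]
      grind
  have l2 := s2.lk (ncard_le_three (p := c) (q := d) (r := d) (by grind)) l1 hDL
  exact l2.mono (by grind)

lemma maxnil_conn_minus {V : Type} [Finite V] {G : SimpleGraph V} {S : Set V} {y : V}
    (h : IsMaxnil (G.induce S)) (hy : y ∈ S) (hne : (S \ {y}).Nonempty) : Conn G (S \ {y}) := by
  refine ⟨hne, ?_⟩
  intro C hC hCne hcl d₀ hd₀
  by_contra hd₀C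
  -- `y` has a neighbour in `C`
  have h1 : ∃ c ∈ C, G.Adj c y := by
    by_contra hno
    push Not at hno
    have := maxnil_connected h (C := C) (hC.trans Set.diff_subset) hCne ?_ hd₀.1
    · exact hd₀C this
    · intro u hu v hv huv
      by_cases hvy : v = y
      · exact absurd (hvy ▸ huv) (hno u hu)
      · exact hcl u hu v ⟨hv, hvy⟩ huv
  -- `y` has a neighbour outside `C`
  have h2 : ∃ d ∈ S \ {y}, d ∉ C ∧ G.Adj d y := by
    by_contra hno
    push Not at hno
    obtain ⟨c, hc⟩ := hCne
    have := maxnil_connected h (C := (S \ {y}) \ C) (fun v hv => hv.1.1) ⟨d₀, hd₀, hd₀C⟩ ?_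
      (hC hc).1
    · exact this.2 hc
    · intro u hu v hv huv
      by_cases hvy : v = y
      · exact absurd (hvy ▸ huv) (hno u hu.1 hu.2)
      · exact ⟨⟨hv, hvy⟩, fun hvC => hu.2 (hcl v hvC u hu.1 huv.symm)⟩
  obtain ⟨c, hc, hcy⟩ := h1
  obtain ⟨d, hd, hdC, hdy⟩ := h2
  obtain ⟨hL, hmax⟩ := maxnil_induce h
  have hcd : c ≠ d := fun h' => hdC (h' ▸ hc)
  refine hmax c (hC hc).1 d hd.1 hcd (fun h' => hdC (hcl c hc d hd h')) ?_
  have hyC : y ∉ C := fun h' => (hC h').2 rfl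
  have hCS : ∀ u ∈ C, u ∈ S ∧ u ≠ y := fun u hu => hC hu
  have hdne : d ≠ y := hd.2
  have hcne : c ≠ y := (hC hc).2
  have hdS : d ∈ S := hd.1
  have hcl' : ∀ u ∈ C, ∀ v ∈ S, v ≠ y → G.Adj u v → v ∈ C := fun u hu v hv hvy =>
    hcl u hu v ⟨hv, hvy⟩
  have hsymm : ∀ u v, G.Adj u v → G.Adj v u := fun u v h' => h'.symm
  have hCL : Lk (addEdge G c d) (C ∪ {y}) := addEdge_lk (hL.mono (by grind)) (Or.inr (by grind))
  have hDL : Lk (addEdge G c d) (S \ C) :=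
    addEdge_lk (hL.mono Set.diff_subset) (Or.inl fun h' => h'.2 hc)
  have s1 : CSum (addEdge G c d) (C ∪ {y}) {y, c, d} := by
    constructor
    · simp only [Set.mem_inter_iff, Set.mem_insert_iff, Set.mem_singleton_iff, Set.mem_union,
        addEdge_adj]
      grind
    · simp only [Set.mem_insert_iff, Set.mem_singleton_iff, addEdge_adj, Set.mem_union]
      grind
  have l1 := s1.lk (ncard_le_three (p := y) (q := c) (r := d) (by grind)) hCL
    (Lk.of_card ((ncard_le_three (p := y) (q := c) (r := d) (by grind)).trans (by norm_num)))
  have s2 : CSum (addEdge G c d) ((C ∪ {y}) ∪ {y, c, d}) (S \ C) := by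
    constructor
    · simp only [Set.mem_inter_iff, Set.mem_insert_iff, Set.mem_singleton_iff, Set.mem_union,
        Set.mem_diff, addEdge_adj]
      grind
    · simp only [Set.mem_insert_iff, Set.mem_singleton_iff, addEdge_adj, Set.mem_union,
        Set.mem_diff]
      grind
  have l2 := s2.lk (ncard_le_three (p := y) (q := d) (r := d) (by grind)) l1 hDL
  exact l2.mono (by grind)

/-- Contracting the connected set `K` onto `x` turns the new edge `ab` into `ax`. -/
lemma lk_contract {V : Type} {G : SimpleGraph V} {S K : Set V} {a b x : V}
    (hK : Conn G K) (hSK : S ∩ K ⊆ {x}) (hx : x ∈ K) (hb : b ∈ K) (haS : a ∈ S) (hab : a ≠ b)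
    (hL : Lk (addEdge G a b) Set.univ) : Lk (addEdge G a x) S := by
  classical
  rintro W P hP ⟨f, hs, hc, hd, ha⟩
  have hKs : ∀ C : Set V, (∀ u ∈ C, ∀ v ∈ K, (addEdge G a b).Adj u v → v ∈ C) →
      (C ∩ K).Nonempty → K ⊆ C := by
    intro C hcl hne
    have := hK.2 (C ∩ K) Set.inter_subset_right hne ?_
    · exact fun v hv => (this hv).1
    · rintro u ⟨huC, _⟩ v hv huv
      exact ⟨hcl u huC v hv (addEdge_adj.2 (Or.inl huv)), hv⟩
  refine hL P hP ⟨fun w => if x ∈ f w then f w ∪ K else f w, fun w => Set.subset_univ _,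
    ?_, ?_, ?_⟩
  · intro w
    by_cases hxw : x ∈ f w
    · simp only [hxw, if_true]
      refine ⟨(hc w).1.mono Set.subset_union_left, ?_⟩
      intro C hC hne hcl
      have hKC := hKs C fun u hu v hv => hcl u hu v (Or.inr hv)
      have hfne : (C ∩ f w).Nonempty := by
        obtain ⟨z, hz⟩ := hne
        rcases hC hz with h' | h'
        · exact ⟨z, hz, h'⟩
        · exact ⟨x, hKC ⟨z, hz, h'⟩ hx, hxw⟩
      have hfC : f w ⊆ C ∩ f w := by
        apply (hc w).2 _ Set.inter_subset_right hfne
        rintro u ⟨huC, huf⟩ v hv huv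
        refine ⟨?_, hv⟩
        rw [addEdge_adj] at huv
        rcases huv with huv | ⟨_, ⟨rfl, rfl⟩ | ⟨rfl, rfl⟩⟩
        · exact hcl u huC v (Or.inl hv) (addEdge_adj.2 (Or.inl huv))
        · have hbC : b ∈ C := hcl u huC b (Or.inr hb)
            (addEdge_adj.2 (Or.inr ⟨hab, Or.inl ⟨rfl, rfl⟩⟩))
          exact hKC ⟨b, hbC, hb⟩ hx
        · have hbC : b ∈ C := hKC ⟨u, huC, hx⟩ hb
          exact hcl b hbC v (Or.inl hv) (addEdge_adj.2 (Or.inr ⟨hab.symm, Or.inr ⟨rfl, rfl⟩⟩))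
      rintro v (hv | hv)
      · exact (hfC hv).1
      · exact hKC ⟨x, (hfC hxw).1, hx⟩ hv
    · simp only [hxw, if_false]
      refine (hc w).congr (S := f w) subset_rfl ?_
      intro u hu v hv huv
      rw [addEdge_adj] at huv ⊢
      rcases huv with huv | ⟨_, ⟨rfl, rfl⟩ | ⟨rfl, rfl⟩⟩
      · exact Or.inl huv
      · exact absurd hv hxw
      · exact absurd hu hxw
  · intro w₁ w₂ hne
    have hdd := Set.disjoint_left.1 (hd w₁ w₂ hne)
    have hKf : ∀ w, ∀ v ∈ f w, v ∈ K → v = x := fun w v hv hvK => hSK ⟨hs w hv, hvK⟩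
    rw [Set.disjoint_left]
    intro v h1 h2
    by_cases hx1 : x ∈ f w₁ <;> by_cases hx2 : x ∈ f w₂ <;>
      simp only [hx1, hx2, if_true, if_false] at h1 h2
    · exact hdd hx1 hx2
    · rcases h1 with h1 | h1
      · exact hdd h1 h2
      · exact hx2 (hKf w₂ v h2 h1 ▸ h2)
    · rcases h2 with h2 | h2
      · exact hdd h1 h2
      · exact hx1 (hKf w₁ v h1 h2 ▸ h1)
    · exact hdd h1 h2
  · intro w₁ w₂ hw
    have hsub : ∀ w, f w ⊆ if x ∈ f w then f w ∪ K else f w := by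
      intro w
      split_ifs
      · exact Set.subset_union_left
      · exact subset_rfl
    have hsubK : ∀ w, x ∈ f w → b ∈ if x ∈ f w then f w ∪ K else f w := by
      intro w hxw
      rw [if_pos hxw]
      exact Or.inr hb
    obtain ⟨u, hu, v, hv, huv⟩ := ha _ _ hw
    rw [addEdge_adj] at huv
    rcases huv with huv | ⟨_, ⟨rfl, rfl⟩ | ⟨rfl, rfl⟩⟩
    · exact ⟨u, hsub _ hu, v, hsub _ hv, addEdge_adj.2 (Or.inl huv)⟩
    · exact ⟨u, hsub _ hu, b, hsubK _ hv, addEdge_adj.2 (Or.inr ⟨hab, Or.inl ⟨rfl, rfl⟩⟩)⟩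
    · exact ⟨b, hsubK _ hu, v, hsub _ hv,
        addEdge_adj.2 (Or.inr ⟨hab.symm, Or.inr ⟨rfl, rfl⟩⟩)⟩

lemma addEdge_comm {V : Type} (G : SimpleGraph V) (a b : V) : addEdge G a b = addEdge G b a := by
  simp only [addEdge, Sym2.eq_swap]

/-- Edges across: `a` on the side where `xy` is non-triangular. -/
lemma cross_not_lk {V : Type} [Finite V] {G : SimpleGraph V} {V₁ V₂ : Set V} {x y a b : V}
    (hI : V₁ ∩ V₂ = {x, y}) (hxy : x ≠ y)
    (h₁ : IsMaxnil (G.induce V₁)) (h₂ : IsMaxnil (G.induce V₂))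
    (ht : ∀ w ∈ V₁, ¬ (G.Adj x w ∧ G.Adj y w))
    (ha1 : a ∈ V₁) (ha2 : a ∉ V₂) (hb2 : b ∈ V₂) (hb1 : b ∉ V₁) :
    ¬ Lk (addEdge G a b) Set.univ := by
  have key : ∀ s t : V, s ≠ t → V₁ ∩ V₂ = {s, t} → ¬ G.Adj s a →
      ¬ Lk (addEdge G a b) Set.univ := by
    intro s t hst hI' hsa hL
    have hs : s ∈ V₁ ∩ V₂ := by rw [hI']; simp
    have ht' : t ∈ V₁ ∩ V₂ := by rw [hI']; simp
    have hK := maxnil_conn_minus h₂ ht'.2 ⟨s, hs.2, hst⟩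
    refine (maxnil_induce h₁).2 a ha1 s hs.1 (fun h => ha2 (h ▸ hs.2)) (fun h => hsa h.symm) ?_
    refine lk_contract (K := V₂ \ {t}) (b := b) hK ?_ ⟨hs.2, hst⟩
      ⟨hb2, fun h => hb1 (by rw [Set.mem_singleton_iff.1 h]; exact ht'.1)⟩ ha1
      (fun h => ha2 (h ▸ hb2)) hL
    rintro z ⟨hz1, hz2, hzt⟩
    have : z ∈ V₁ ∩ V₂ := ⟨hz1, hz2⟩
    rw [hI'] at this
    exact this.resolve_right hzt
  by_cases hxa : G.Adj x a
  · exact key y x hxy.symm (by rw [hI, Set.pair_comm]) fun hya => ht a ha1 ⟨hxa, hya⟩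
  · exact key x y hxy hI hxa

/-- Let `G` be the clique sum over `K₂` (the edge `xy`) of maxnil graphs
`G₁ = G.induce V₁` and `G₂ = G.induce V₂`. Then `G` is maxnil iff the edge `xy` is
non-triangular in at least one of `G₁`, `G₂`. -/
theorem stmt_6 {V : Type} [Fintype V] (G : SimpleGraph V) (V₁ V₂ : Set V) (x y : V)
    (hU : V₁ ∪ V₂ = Set.univ) (hI : V₁ ∩ V₂ = {x, y}) (hxy : x ≠ y)
    (he : G.Adj x y)
    (hE : ∀ a b : V, G.Adj a b → (a ∈ V₁ ∧ b ∈ V₁) ∨ (a ∈ V₂ ∧ b ∈ V₂))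
    (h₁ : IsMaxnil (G.induce V₁)) (h₂ : IsMaxnil (G.induce V₂)) :
    IsMaxnil G ↔
      ((∀ w ∈ V₁, ¬ (G.Adj x w ∧ G.Adj y w)) ∨
       (∀ w ∈ V₂, ¬ (G.Adj x w ∧ G.Adj y w))) := by
  have hsymm : ∀ u v, G.Adj u v → G.Adj v u := fun u v h' => h'.symm
  have hm1 := maxnil_induce h₁
  have hm2 := maxnil_induce h₂
  have hmem : ∀ z, (z ∈ V₁ ∧ z ∈ V₂) ↔ (z = x ∨ z = y) := by
    intro z
    have : z ∈ V₁ ∩ V₂ ↔ z ∈ ({x, y} : Set V) := by rw [hI]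
    exact this
  have hor : ∀ z, z ∈ V₁ ∨ z ∈ V₂ := by
    intro z
    have : z ∈ V₁ ∪ V₂ := by rw [hU]; trivial
    exact this
  constructor
  · intro hG
    by_contra hcon
    push Not at hcon
    obtain ⟨⟨w₁, hw₁, hxw₁, hyw₁⟩, w₂, hw₂, hxw₂, hyw₂⟩ := hcon
    have n1 : w₁ ∉ V₂ := by
      intro h
      rcases (hmem w₁).1 ⟨hw₁, h⟩ with rfl | rfl
      · exact hxw₁.ne rfl
      · exact hyw₁.ne rfl
    have n2 : w₂ ∉ V₁ := by
      intro h
      rcases (hmem w₂).1 ⟨h, hw₂⟩ with rfl | rfl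
      · exact hxw₂.ne rfl
      · exact hyw₂.ne rfl
    have hne : w₁ ≠ w₂ := fun h => n1 (h ▸ hw₂)
    refine hG.2 w₁ w₂ hne (fun h => ?_) (isLinkless_iff.2 ?_)
    · rcases hE _ _ h with h' | h'
      · exact n2 h'.2
      · exact n1 h'.1
    have L1 : Lk (addEdge G w₁ w₂) V₁ := addEdge_lk hm1.1 (Or.inr n2)
    have L2 : Lk (addEdge G w₁ w₂) V₂ := addEdge_lk hm2.1 (Or.inl n1)
    have hx := (hmem x).2 (Or.inl rfl)
    have hy := (hmem y).2 (Or.inr rfl)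
    have s1 : CSum (addEdge G w₁ w₂) V₁ {x, y, w₁, w₂} := by
      constructor
      · simp only [Set.mem_inter_iff, Set.mem_insert_iff, Set.mem_singleton_iff, addEdge_adj]
        grind
      · simp only [Set.mem_insert_iff, Set.mem_singleton_iff, addEdge_adj]
        grind
    have c1 : V₁ ∩ {x, y, w₁, w₂} ⊆ {x, y, w₁} := by
      rintro z ⟨hz, hz'⟩
      simp only [Set.mem_insert_iff, Set.mem_singleton_iff] at hz' ⊢
      rcases hz' with h | h | h | h
      · exact Or.inl h
      · exact Or.inr (Or.inl h)
      · exact Or.inr (Or.inr h)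
      · exact absurd (h ▸ hz) n2
    have c2 : (V₁ ∪ {x, y, w₁, w₂}) ∩ V₂ ⊆ {x, y, w₂} := by
      rintro z ⟨hz, hz2⟩
      simp only [Set.mem_insert_iff, Set.mem_singleton_iff, Set.mem_union] at hz ⊢
      rcases hz with h | h | h | h | h
      · rcases (hmem z).1 ⟨h, hz2⟩ with h | h
        · exact Or.inl h
        · exact Or.inr (Or.inl h)
      · exact Or.inl h
      · exact Or.inr (Or.inl h)
      · exact absurd (h ▸ hz2) n1
      · exact Or.inr (Or.inr h)
    have l1 := s1.lk (ncard_le_three (p := x) (q := y) (r := w₁) c1) L1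
      (Lk.of_card (ncard_le_four.trans (by norm_num)))
    have s2 : CSum (addEdge G w₁ w₂) (V₁ ∪ {x, y, w₁, w₂}) V₂ := by
      constructor
      · simp only [Set.mem_inter_iff, Set.mem_insert_iff, Set.mem_singleton_iff, Set.mem_union,
          addEdge_adj]
        grind
      · simp only [Set.mem_insert_iff, Set.mem_singleton_iff, addEdge_adj, Set.mem_union]
        grind
    have l2 := s2.lk (ncard_le_three (p := x) (q := y) (r := w₂) c2) l1 L2
    refine l2.mono (fun z _ => ?_)
    rcases hor z with h | h
    · exact Or.inl (Or.inl h)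
    · exact Or.inr h
  · intro ht
    refine ⟨isLinkless_iff.2 ?_, ?_⟩
    · have s : CSum G V₁ V₂ := by
        constructor
        · simp only [Set.mem_inter_iff, hmem]
          grind
        · grind
      have := s.lk (ncard_le_three (p := x) (q := y) (r := y) (by rw [hI]; grind)) hm1.1 hm2.1
      rwa [hU] at this
    · intro a b hab hadj hL
      have hL := isLinkless_iff.1 hL
      by_cases hs1 : a ∈ V₁ ∧ b ∈ V₁
      · exact hm1.2 a hs1.1 b hs1.2 hab hadj (hL.mono (Set.subset_univ _))
      by_cases hs2 : a ∈ V₂ ∧ b ∈ V₂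
      · exact hm2.2 a hs2.1 b hs2.2 hab hadj (hL.mono (Set.subset_univ _))
      have hL' : Lk (addEdge G b a) Set.univ := by rwa [addEdge_comm]
      have hI' : V₂ ∩ V₁ = {x, y} := by rw [Set.inter_comm, hI]
      have hcase : (a ∈ V₁ ∧ a ∉ V₂ ∧ b ∈ V₂ ∧ b ∉ V₁) ∨
          (b ∈ V₁ ∧ b ∉ V₂ ∧ a ∈ V₂ ∧ a ∉ V₁) := by
        have := hor a
        have := hor b
        tauto
      rcases ht with ht | ht <;> rcases hcase with ⟨p1, p2, p3, p4⟩ | ⟨p1, p2, p3, p4⟩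
      · exact cross_not_lk hI hxy h₁ h₂ ht p1 p2 p3 p4 hL
      · exact cross_not_lk hI hxy h₁ h₂ ht p1 p2 p3 p4 hL'
      · exact cross_not_lk hI' hxy h₂ h₁ ht p3 p4 p1 p2 hL'
      · exact cross_not_lk hI' hxy h₂ h₁ ht p3 p4 p1 p2 hL
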